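/- arXiv:2411.05385 — 2 statements merged into one kernel-verified Lean document; each statement's English description precedes it below -/
import Mathlib

section
/- Let K ∈ ℂ^{n×n} with n = n₁+⋯+n_d, n ≥ 2, and let c ∈ ℂ be nonzero. If c·det(I_n ⊗ I_m − (K ⊗ I_m)(⊕_{j=1}^d I_{n_j} ⊗ U_j)) ≠ 0 for every m ∈ {1,…,n−1} and every d-tuple (U₁,…,U_d) of m×m unitary matrices, then there exists an invertible block diagonal matrix S = ⊕_{j=1}^d S_j with S_j ∈ ℂ^{n_j×n_j} such that S⁻¹KS is a strict J-contraction for some diagonal signature matrix J. -/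
open Matrix Kronecker
open scoped ComplexOrder

/-- The index type for the block decomposition `n = n₁ + ⋯ + n_d`:
`BIdx nn ≃ Fin (n₁ + ⋯ + n_d)`. -/
abbrev BIdx {d : ℕ} (nn : Fin d → ℕ) : Type := (j : Fin d) × Fin (nn j)

/-- The block diagonal matrix `⊕_{j=1}^d I_{n_j} ⊗ U_j` acting on `ℂ^{n m}`. -/
def oplusKron {d : ℕ} (nn : Fin d → ℕ) {m : ℕ}
    (U : ∀ _ : Fin d, Matrix (Fin m) (Fin m) ℂ) :
    Matrix (BIdx nn × Fin m) (BIdx nn × Fin m) ℂ :=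
  fun p q => if p.1 = q.1 then U p.1.1 p.2 q.2 else 0

/-- `p(U₁,…,U_d) = c · det(I_n ⊗ I_m − (K ⊗ I_m)(⊕_{j=1}^d I_{n_j} ⊗ U_j))`. -/
noncomputable def ncDet {d : ℕ} (nn : Fin d → ℕ)
    (K : Matrix (BIdx nn) (BIdx nn) ℂ) (c : ℂ) {m : ℕ}
    (U : ∀ _ : Fin d, Matrix (Fin m) (Fin m) ℂ) : ℂ :=
  c * Matrix.det ((1 : Matrix (BIdx nn × Fin m) (BIdx nn × Fin m) ℂ) -
      (K ⊗ₖ (1 : Matrix (Fin m) (Fin m) ℂ)) * oplusKron nn U)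

/-- A diagonal signature matrix: a diagonal matrix with each diagonal entry `1` or `-1`. -/
def IsDiagSignature {ι : Type*} [DecidableEq ι] (J : Matrix ι ι ℂ) : Prop :=
  ∃ e : ι → ℂ, (∀ i, e i = 1 ∨ e i = -1) ∧ J = Matrix.diagonal e

/-- There is an invertible block diagonal `S = ⊕_{j=1}^d S_j` such that `S⁻¹ K S` is a
strict `J`-contraction (`J - (S⁻¹KS) J (S⁻¹KS)* ≻ 0`) for some diagonal signature matrix `J`. -/
noncomputable def StructSimStrictContr {d : ℕ} (nn : Fin d → ℕ)
    (K : Matrix (BIdx nn) (BIdx nn) ℂ) : Prop :=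
  ∃ S : ∀ j : Fin d, Matrix (Fin (nn j)) (Fin (nn j)) ℂ,
    IsUnit (Matrix.blockDiagonal' S) ∧
    ∃ J : Matrix (BIdx nn) (BIdx nn) ℂ, IsDiagSignature J ∧
      (J - ((Matrix.blockDiagonal' S)⁻¹ * K * Matrix.blockDiagonal' S) * J *
        ((Matrix.blockDiagonal' S)⁻¹ * K * Matrix.blockDiagonal' S)ᴴ).PosDef

theorem Matrix.IsHermitian.exists_unitary_diagonal {ι : Type*} [Fintype ι] [DecidableEq ι]
    {A : Matrix ι ι ℂ} (hA : A.IsHermitian) :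
    ∃ U ∈ Matrix.unitaryGroup ι ℂ, ∃ e : ι → ℝ,
      A = U * diagonal (fun i => (e i : ℂ)) * Uᴴ := by
  refine ⟨hA.eigenvectorUnitary, hA.eigenvectorUnitary.2, hA.eigenvalues, ?_⟩
  conv_lhs => rw [hA.spectral_theorem]
  simp [Unitary.conjStarAlgAut_apply, star_eq_conjTranspose, Function.comp_def]

theorem isUnit_of_mem_unitaryGroup {ι : Type*} [Fintype ι] [DecidableEq ι]
    {U : Matrix ι ι ℂ} (hU : U ∈ Matrix.unitaryGroup ι ℂ) : IsUnit U :=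
  IsUnit.of_mul_eq_one _ (mem_unitaryGroup_iff.mp hU)

/-- Simultaneous diagonalization by congruence of a positive definite and a Hermitian matrix. -/
theorem Matrix.PosDef.exists_simultaneous_diagonal {ι : Type*} [Fintype ι] [DecidableEq ι]
    {Q R : Matrix ι ι ℂ} (hQ : Q.PosDef) (hR : R.IsHermitian) :
    ∃ C : Matrix ι ι ℂ, IsUnit C ∧ Q = C * Cᴴ ∧
      ∃ e : ι → ℝ, R = C * diagonal (fun i => (e i : ℂ)) * Cᴴ := by
  obtain ⟨B, hB, rfl⟩ : ∃ B : Matrix ι ι ℂ, IsUnit B ∧ Q = B * Bᴴ := by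
    obtain ⟨U, hU, q, hq⟩ := hQ.isHermitian.exists_unitary_diagonal
    have hUu : IsUnit U := isUnit_of_mem_unitaryGroup hU
    have hpos : ∀ i, 0 < q i := by
      rw [hq, ← star_eq_conjTranspose, hUu.posDef_star_right_conjugate_iff,
        posDef_diagonal_iff] at hQ
      exact fun i => Complex.zero_lt_real.mp (hQ i)
    refine ⟨U * diagonal (fun i => (Real.sqrt (q i) : ℂ)), hUu.mul ?_, ?_⟩
    · rw [Matrix.isUnit_iff_isUnit_det, det_diagonal, isUnit_iff_ne_zero, Finset.prod_ne_zero_iff]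
      exact fun i _ => Complex.ofReal_ne_zero.mpr (Real.sqrt_pos.mpr (hpos i)).ne'
    · rw [hq, conjTranspose_mul, diagonal_conjTranspose, Matrix.mul_assoc U (diagonal _),
        Matrix.mul_assoc U (diagonal _), ← Matrix.mul_assoc (diagonal _) (diagonal _),
        diagonal_mul_diagonal]
      congr 3
      ext i
      simp only [Pi.star_apply, RCLike.star_def, Complex.conj_ofReal]
      rw [← Complex.ofReal_mul, Real.mul_self_sqrt (hpos i).le]
  have hB' : IsUnit B.det := (Matrix.isUnit_iff_isUnit_det _).mp hB
  have hB'' : IsUnit Bᴴ.det := by rw [det_conjTranspose]; exact hB'.star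
  have hM : (B⁻¹ * R * (B⁻¹)ᴴ).IsHermitian :=
    isHermitian_mul_mul_conjTranspose _ hR
  obtain ⟨V, hV, e, he⟩ := hM.exists_unitary_diagonal
  refine ⟨B * V, hB.mul (isUnit_of_mem_unitaryGroup hV), ?_, e, ?_⟩
  · have : V * Vᴴ = 1 := mem_unitaryGroup_iff.mp hV
    rw [conjTranspose_mul, Matrix.mul_assoc, ← Matrix.mul_assoc V, this, Matrix.one_mul]
  · have h2 : R = B * (B⁻¹ * R * (B⁻¹)ᴴ) * Bᴴ := by
      rw [conjTranspose_nonsing_inv]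
      simp only [Matrix.mul_assoc]
      rw [nonsing_inv_mul _ hB'', Matrix.mul_one, mul_nonsing_inv_cancel_left _ _ hB']
    rw [h2, he, conjTranspose_mul]
    simp only [Matrix.mul_assoc]

theorem exists_unitary_of_mul_conjTranspose_eq {κ μ : Type*} [Fintype κ] [Fintype μ]
    [DecidableEq κ] [DecidableEq μ] (A B : Matrix κ μ ℂ) (h : A * Aᴴ = B * Bᴴ) :
    ∃ V ∈ Matrix.unitaryGroup μ ℂ, B = A * V := by
  let f := toEuclideanLin Aᴴ
  let g := toEuclideanLin Bᴴ
  have hn : ∀ x, ‖f x‖ = ‖g x‖ := by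
    have key : ∀ (D : Matrix κ μ ℂ) (x : EuclideanSpace ℂ κ),
        ‖toEuclideanLin Dᴴ x‖ ^ 2 = (star x.ofLp ⬝ᵥ ((D * Dᴴ) *ᵥ x.ofLp)).re := by
      intro D x
      rw [← inner_self_eq_norm_sq (𝕜 := ℂ), EuclideanSpace.inner_eq_star_dotProduct,
        dotProduct_comm, ofLp_toLpLin, toLin'_apply, star_mulVec, conjTranspose_conjTranspose,
        ← dotProduct_mulVec, mulVec_mulVec]
      rfl
    intro x
    rw [← sq_eq_sq₀ (norm_nonneg _) (norm_nonneg _), key, key, h]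
  obtain ⟨s, hs⟩ := f.rangeRestrict.exists_rightInverse_of_surjective f.range_rangeRestrict
  have hs' : ∀ y, f (s y) = y := fun y => congrArg Subtype.val (LinearMap.congr_fun hs y)
  let L : LinearMap.range f →ₗᵢ[ℂ] EuclideanSpace ℂ μ :=
    ⟨g ∘ₗ s, fun y => by rw [LinearMap.comp_apply, ← hn, hs']; rfl⟩
  have hL : ∀ x, L.extend (f x) = g x := by
    intro x
    have h1 : L.extend (f x) = g (s ⟨f x, x, rfl⟩) := L.extend_apply ⟨f x, x, rfl⟩
    rw [h1, ← sub_eq_zero, ← map_sub, ← norm_eq_zero, ← hn, map_sub, hs', sub_self, norm_zero]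
  let W : Matrix μ μ ℂ := toEuclideanLin.symm L.extend.toLinearMap
  have hW : W ∈ Matrix.unitaryGroup μ ℂ := by
    rw [mem_unitaryGroup_iff']
    ext i j
    rw [star_eq_conjTranspose, ← inner_matrix_col_col]
    have hcol : ∀ i, WithLp.toLp 2 (Wᵀ i) = L.extend (EuclideanSpace.single i 1) := by
      intro i
      have : toEuclideanLin W = L.extend.toLinearMap := LinearEquiv.apply_symm_apply _ _
      rw [← LinearIsometry.coe_toLinearMap, ← this, toLpLin_apply]
      congr 1
      ext k
      simp
    rw [hcol, hcol, LinearIsometry.inner_map_map, EuclideanSpace.inner_single_left]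
    simp [Matrix.one_apply]
  have hWA : W * Aᴴ = Bᴴ := by
    apply toEuclideanLin.injective
    ext1 x
    rw [← hL x]
    have : toEuclideanLin W = L.extend.toLinearMap := LinearEquiv.apply_symm_apply _ _
    rw [← LinearIsometry.coe_toLinearMap, ← this]
    simp [f, toLpLin_apply]
  refine ⟨Wᴴ, ?_, ?_⟩
  · exact Unitary.star_mem hW
  · rw [← conjTranspose_conjTranspose B, ← hWA]; simp

theorem Matrix.PosSemidef.exists_factor_of_det_eq_zero {ι : Type*} [Fintype ι] [DecidableEq ι]
    {H : Matrix ι ι ℂ} (hH : H.PosSemidef) (hdet : H.det = 0) {N : ℕ}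
    (hN : Fintype.card ι = N + 1) : ∃ Y : Matrix ι (Fin N) ℂ, H = Y * Yᴴ := by
  obtain ⟨U, hU, e, he⟩ := hH.isHermitian.exists_unitary_diagonal
  have hUu : IsUnit U := isUnit_of_mem_unitaryGroup hU
  have hpos : ∀ i, 0 ≤ e i := by
    rw [he, ← star_eq_conjTranspose, hUu.posSemidef_star_right_conjugate_iff,
      posSemidef_diagonal_iff] at hH
    exact fun i => Complex.zero_le_real.mp (hH i)
  obtain ⟨i₀, hi₀⟩ : ∃ i, e i = 0 := by
    rw [he, det_mul, det_mul, det_diagonal, det_conjTranspose] at hdet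
    have hd : U.det ≠ 0 := ((Matrix.isUnit_iff_isUnit_det _).mp hUu).ne_zero
    simpa [hd, Finset.prod_eq_zero_iff] using hdet
  have hc : Fintype.card {i // i ≠ i₀} = Fintype.card (Fin N) := by
    simp [Fintype.card_subtype_compl, hN]
  let φ := Fintype.equivOfCardEq hc
  refine ⟨of fun p a => U p (φ.symm a).1 * (Real.sqrt (e (φ.symm a).1) : ℂ), ?_⟩
  ext p q
  rw [he, Matrix.mul_apply, Matrix.mul_apply]
  rw [Fintype.sum_eq_add_sum_subtype_ne _ i₀, ← φ.sum_comp]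
  simp only [mul_diagonal, conjTranspose_apply, of_apply, hi₀, φ.symm_apply_apply]
  rw [Complex.ofReal_zero, mul_zero, zero_mul, zero_add]
  refine Finset.sum_congr rfl fun i _ => ?_
  simp only [map_mul, RCLike.star_def, Complex.conj_ofReal]
  conv_lhs => rw [← Real.mul_self_sqrt (hpos i), Complex.ofReal_mul]
  ring

theorem isCompact_posSemidef_trace_one (ι : Type*) [Fintype ι] [DecidableEq ι] :
    IsCompact {H : Matrix ι ι ℂ | H.PosSemidef ∧ H.trace = 1} := by
  have hK : IsCompact (Set.univ.pi fun _ : ι => Set.univ.pi fun _ : ι =>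
      Metric.closedBall (0 : ℂ) 1) :=
    isCompact_univ_pi fun _ => isCompact_univ_pi fun _ => isCompact_closedBall _ _
  refine IsCompact.of_isClosed_subset (X := Matrix ι ι ℂ) hK ?_ ?_
  · simp only [posSemidef_iff_dotProduct_mulVec, Set.ofPred_and, Set.ofPred_forall]
    refine IsClosed.inter (IsClosed.inter ?_ (isClosed_iInter fun x => ?_)) ?_
    · exact isClosed_eq (by fun_prop) continuous_id
    · exact isClosed_le continuous_const (by fun_prop)
    · exact isClosed_eq (by fun_prop) continuous_const
  · rintro H ⟨hH, htr⟩ p - q -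
    obtain ⟨U, hU, e, he⟩ := hH.isHermitian.exists_unitary_diagonal
    have hpos : ∀ i, 0 ≤ e i := by
      rw [he, ← star_eq_conjTranspose,
        (isUnit_of_mem_unitaryGroup hU).posSemidef_star_right_conjugate_iff,
        posSemidef_diagonal_iff] at hH
      exact fun i => Complex.zero_le_real.mp (hH i)
    have hsum : ∑ i, e i = 1 := by
      have h1 : Uᴴ * U = 1 := mem_unitaryGroup_iff'.mp hU
      rw [he, trace_mul_cycle, h1, Matrix.one_mul, trace_diagonal] at htr
      exact_mod_cast htr
    rw [mem_closedBall_zero_iff, he, Matrix.mul_apply, ← hsum]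
    refine norm_sum_le_of_le _ fun i _ => ?_
    rw [mul_diagonal, conjTranspose_apply, norm_mul, norm_mul, norm_star, Complex.norm_real,
      Real.norm_of_nonneg (hpos i)]
    have h1 := entry_norm_bound_of_unitary hU p i
    have h2 := entry_norm_bound_of_unitary hU q i
    calc ‖U p i‖ * e i * ‖U q i‖ ≤ 1 * e i * 1 := by
          gcongr <;> simpa using hpos i
      _ = e i := by ring

theorem convex_posSemidef_trace_one (ι : Type*) [Fintype ι] :
    Convex ℝ {H : Matrix ι ι ℂ | H.PosSemidef ∧ H.trace = 1} := by
  rintro A ⟨hA, hA1⟩ B ⟨hB, hB1⟩ a b ha hb hab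
  refine ⟨(hA.smul ha).add (hB.smul hb), ?_⟩
  rw [trace_add, trace_smul, trace_smul, hA1, hB1, ← add_smul, hab, one_smul]

/-- The entries of `H - Kᴴ H K` inside the diagonal blocks. -/
def blockDefect {d : ℕ} {nn : Fin d → ℕ} (K : Matrix (BIdx nn) (BIdx nn) ℂ) :
    Matrix (BIdx nn) (BIdx nn) ℂ →ₗ[ℂ]
      ({x : BIdx nn × BIdx nn // x.1.1 = x.2.1} → ℂ) where
  toFun H x := (H - Kᴴ * H * K) x.1.1 x.1.2
  map_add' A B := by
    ext x
    simp only [Matrix.mul_add, Matrix.add_mul, Matrix.sub_apply, Matrix.add_apply, Pi.add_apply]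
    ring
  map_smul' a A := by
    ext x
    simp [mul_sub]

theorem blockDefect_apply {d : ℕ} {nn : Fin d → ℕ} (K H : Matrix (BIdx nn) (BIdx nn) ℂ)
    (x : {x : BIdx nn × BIdx nn // x.1.1 = x.2.1}) :
    blockDefect K H x = (H - Kᴴ * H * K) x.1.1 x.1.2 := rfl

theorem exists_blockDefect_eq_trace {d : ℕ} {nn : Fin d → ℕ}
    (K : Matrix (BIdx nn) (BIdx nn) ℂ)
    (f : ({x : BIdx nn × BIdx nn // x.1.1 = x.2.1} → ℂ) →ₗ[ℂ] ℂ) :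
    ∃ G : ∀ j, Matrix (Fin (nn j)) (Fin (nn j)) ℂ, ∀ H,
      f (blockDefect K H) = (blockDiagonal' G * (H - Kᴴ * H * K)).trace := by
  refine ⟨fun j => of fun a b => f (Pi.single ⟨(⟨j, b⟩, ⟨j, a⟩), rfl⟩ 1), fun H => ?_⟩
  set G : ∀ j, Matrix (Fin (nn j)) (Fin (nn j)) ℂ :=
    fun j => of fun a b => f (Pi.single ⟨(⟨j, b⟩, ⟨j, a⟩), rfl⟩ 1) with hG
  set M := H - Kᴴ * H * K with hM
  rw [trace_mul_comm, f.pi_apply_eq_sum_univ]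
  have h1 : (M * blockDiagonal' G).trace =
      ∑ x : BIdx nn × BIdx nn, M x.1 x.2 * blockDiagonal' G x.2 x.1 := by
    simp only [trace, diag_apply, Matrix.mul_apply]
    rw [Fintype.sum_prod_type]
  rw [h1, ← Finset.sum_filter_of_ne (p := fun x : BIdx nn × BIdx nn => x.1.1 = x.2.1),
    Finset.sum_subtype (p := fun x : BIdx nn × BIdx nn => x.1.1 = x.2.1) _ (by simp)]
  · refine Finset.sum_congr rfl fun x _ => ?_
    obtain ⟨⟨⟨j, b⟩, ⟨j', a⟩⟩, h⟩ := x
    obtain rfl : j = j' := h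
    rw [blockDefect_apply, ← hM, smul_eq_mul, blockDiagonal'_apply_eq]
    simp only [hG, of_apply]
    congr 2
    ext y
    simp [Pi.single_apply, eq_comm]
  · rintro ⟨⟨j, b⟩, ⟨j', a⟩⟩ - hne
    by_contra hjj
    exact hne (by rw [blockDiagonal'_apply_ne _ _ _ (Ne.symm hjj), mul_zero])

theorem exists_posDef_or_blockDefect_eq_zero {d : ℕ} {nn : Fin d → ℕ}
    (K : Matrix (BIdx nn) (BIdx nn) ℂ) :
    (∃ P : ∀ j, Matrix (Fin (nn j)) (Fin (nn j)) ℂ, (∀ j, (P j).IsHermitian) ∧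
      (blockDiagonal' P - K * blockDiagonal' P * Kᴴ).PosDef) ∨
    ∃ H : Matrix (BIdx nn) (BIdx nn) ℂ, H.PosSemidef ∧ H ≠ 0 ∧ blockDefect K H = 0 := by
  by_cases h0 : (0 : {x : BIdx nn × BIdx nn // x.1.1 = x.2.1} → ℂ) ∈
      blockDefect K '' {H | H.PosSemidef ∧ H.trace = 1}
  · right
    obtain ⟨H, ⟨hH, htr⟩, h⟩ := h0
    refine ⟨H, hH, ?_, h⟩
    rintro rfl
    simp at htr
  left
  have hcont : Continuous (blockDefect K) := by
    refine continuous_pi fun x => ?_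
    simp only [blockDefect_apply, Matrix.sub_apply]
    fun_prop
  have hconv : Convex ℝ (blockDefect K '' {H | H.PosSemidef ∧ H.trace = 1}) :=
    (convex_posSemidef_trace_one _).linear_image ((blockDefect K).restrictScalars ℝ)
  obtain ⟨f, u, hfu, hf⟩ := RCLike.geometric_hahn_banach_point_closed (𝕜 := ℂ) hconv
    ((isCompact_posSemidef_trace_one _).image hcont).isClosed h0
  obtain ⟨G, hG⟩ := exists_blockDefect_eq_trace K f.toLinearMap
  have hpos : ∀ x : BIdx nn → ℂ, x ≠ 0 → 0 < (f (blockDefect K (vecMulVec x (star x)))).re := by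
    intro x hx
    have ht : 0 < star x ⬝ᵥ x := dotProduct_star_self_pos_iff.mpr hx
    obtain ⟨t, htx⟩ : ∃ t : ℝ, star x ⬝ᵥ x = t := ⟨_, (Complex.eq_re_of_ofReal_le ht.le)⟩
    rw [htx, Complex.zero_lt_real] at ht
    have := hf _ ⟨(t⁻¹ : ℂ) • vecMulVec x (star x), ⟨?_, ?_⟩, rfl⟩
    · rw [map_zero, map_zero] at hfu
      have h2 := hfu.trans this
      rw [map_smul, map_smul, ← Complex.ofReal_inv, smul_eq_mul, RCLike.re_to_complex,
        Complex.re_ofReal_mul] at h2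
      exact (mul_pos_iff_of_pos_left (inv_pos.mpr ht)).mp h2
    · refine (posSemidef_vecMulVec_self_star x).smul ?_
      rw [← Complex.ofReal_inv, Complex.zero_le_real]
      positivity
    · rw [trace_smul, trace_vecMulVec, dotProduct_comm, htx, smul_eq_mul]
      exact inv_mul_cancel₀ (Complex.ofReal_ne_zero.mpr ht.ne')
  refine ⟨fun j => G j + (G j)ᴴ, fun j => isHermitian_add_transpose_self _, ?_⟩
  have hBD : blockDiagonal' (fun j => G j + (G j)ᴴ) = blockDiagonal' G + (blockDiagonal' G)ᴴ := by
    rw [blockDiagonal'_conjTranspose, ← blockDiagonal'_add]; rfl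
  rw [hBD]
  set B := blockDiagonal' G
  have hBh : (B + Bᴴ).IsHermitian := isHermitian_add_transpose_self _
  refine PosDef.of_dotProduct_mulVec_pos
    (hBh.sub (isHermitian_mul_mul_conjTranspose _ hBh)) fun x hx => ?_
  set X := vecMulVec x (star x)
  have hX : X.IsHermitian := (posSemidef_vecMulVec_self_star x).isHermitian
  have hM : (X - Kᴴ * X * K).IsHermitian := hX.sub (isHermitian_conjTranspose_mul_mul _ hX)
  have h1 : star x ⬝ᵥ ((B + Bᴴ - K * (B + Bᴴ) * Kᴴ) *ᵥ x) =
      ((B + Bᴴ) * (X - Kᴴ * X * K)).trace := by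
    have h2 : star x ⬝ᵥ ((B + Bᴴ - K * (B + Bᴴ) * Kᴴ) *ᵥ x) =
        ((B + Bᴴ - K * (B + Bᴴ) * Kᴴ) * X).trace := by
      rw [mul_vecMulVec, trace_vecMulVec, dotProduct_comm]
    rw [h2, Matrix.sub_mul, Matrix.mul_sub, trace_sub, trace_sub]
    congr 1
    rw [Matrix.mul_assoc K, Matrix.mul_assoc K, trace_mul_comm]
    simp only [Matrix.mul_assoc]
  have h3 : (Bᴴ * (X - Kᴴ * X * K)).trace = star (B * (X - Kᴴ * X * K)).trace := by
    rw [← trace_conjTranspose, conjTranspose_mul, hM.eq, trace_mul_comm]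
  rw [h1, Matrix.add_mul, trace_add, h3, ← hG, RCLike.star_def, Complex.add_conj,
    Complex.zero_lt_real]
  exact mul_pos two_pos (hpos x hx)

theorem blockDefect_conjTranspose {d : ℕ} {nn : Fin d → ℕ} {K X : Matrix (BIdx nn) (BIdx nn) ℂ}
    (hX : blockDefect K X = 0) : blockDefect K Xᴴ = 0 := by
  ext x
  have h1 : Xᴴ - Kᴴ * Xᴴ * K = (X - Kᴴ * X * K)ᴴ := by
    simp [Matrix.mul_assoc]
  have h2 := congrFun hX ⟨(x.1.2, x.1.1), x.2.symm⟩
  rw [blockDefect_apply] at h2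
  rw [blockDefect_apply, h1, conjTranspose_apply, h2, Pi.zero_apply, star_zero, Pi.zero_apply]

theorem exists_isHermitian_blockDefect_eq_zero {d : ℕ} {nn : Fin d → ℕ}
    (K H : Matrix (BIdx nn) (BIdx nn) ℂ) {p q : BIdx nn} (hpq : p.1 ≠ q.1) :
    ∃ R : Matrix (BIdx nn) (BIdx nn) ℂ, R.IsHermitian ∧ blockDefect K R = 0 ∧
      R ∉ Submodule.span ℂ {H} := by
  obtain ⟨X, hX, hXH⟩ : ∃ X, blockDefect K X = 0 ∧ X ∉ Submodule.span ℂ {H} := by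
    by_contra! hcon
    have hle : LinearMap.ker (blockDefect K) ≤ Submodule.span ℂ {H} :=
      fun X hX => hcon X (LinearMap.mem_ker.mp hX)
    have h1 : Module.finrank ℂ (LinearMap.ker (blockDefect K)) ≤ 1 :=
      (Submodule.finrank_mono hle).trans ((finrank_span_le_card _).trans (by simp))
    have h2 := (blockDefect K).finrank_range_add_finrank_ker
    have h3 := Submodule.finrank_le (LinearMap.range (blockDefect K))
    rw [Module.finrank_matrix, Module.finrank_self, mul_one, ← Fintype.card_prod] at h2
    rw [Module.finrank_fintype_fun_eq_card] at h3
    have h4 := Fintype.card_subtype_compl (fun x : BIdx nn × BIdx nn => x.1.1 = x.2.1)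
    have h5 := Fintype.card_subtype_le (fun x : BIdx nn × BIdx nn => x.1.1 = x.2.1)
    have h6 : 1 < Fintype.card {x : BIdx nn × BIdx nn // ¬ x.1.1 = x.2.1} := by
      refine Fintype.one_lt_card_iff.mpr ⟨⟨(p, q), hpq⟩, ⟨(q, p), hpq.symm⟩, fun h => hpq ?_⟩
      exact congrArg Sigma.fst (congrArg Prod.fst (congrArg Subtype.val h))
    omega
  by_contra! hcon
  have hA : X + Xᴴ ∈ Submodule.span ℂ {H} :=
    hcon _ (isHermitian_add_transpose_self X)
      (by rw [map_add, hX, blockDefect_conjTranspose hX, add_zero])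
  have hB : Complex.I • (X - Xᴴ) ∈ Submodule.span ℂ {H} := by
    refine hcon _ ?_
      (by rw [map_smul, map_sub, hX, blockDefect_conjTranspose hX, sub_zero, smul_zero])
    rw [IsHermitian, conjTranspose_smul, conjTranspose_sub, conjTranspose_conjTranspose,
      RCLike.star_def, Complex.conj_I, neg_smul, ← smul_neg, neg_sub]
  refine hXH ?_
  have : X = (2⁻¹ : ℂ) • ((X + Xᴴ) - Complex.I • (Complex.I • (X - Xᴴ))) := by
    rw [smul_smul, Complex.I_mul_I]
    module
  rw [this]
  exact Submodule.smul_mem _ _ (Submodule.sub_mem _ hA (Submodule.smul_mem _ _ hB))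

theorem Matrix.PosDef.exists_singular_posSemidef {ι : Type*} [Fintype ι] [DecidableEq ι]
    [Nonempty ι] {H R : Matrix ι ι ℂ} (hH : H.PosDef) (hR : R.IsHermitian)
    (hRH : R ∉ Submodule.span ℂ {H}) :
    ∃ t : ℂ, (t • H - R).PosSemidef ∧ t • H - R ≠ 0 ∧ (t • H - R).det = 0 := by
  obtain ⟨C, hC, hHC, e, he⟩ := hH.exists_simultaneous_diagonal hR
  obtain ⟨i₀, hi₀⟩ := Finite.exists_max e
  have hdiff : (e i₀ : ℂ) • H - R = C * diagonal (fun i => ((e i₀ - e i : ℝ) : ℂ)) * Cᴴ := by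
    have : diagonal (fun i => ((e i₀ - e i : ℝ) : ℂ)) =
        (e i₀ : ℂ) • (1 : Matrix ι ι ℂ) - diagonal (fun i => (e i : ℂ)) := by
      rw [smul_one_eq_diagonal, diagonal_sub]
      simp
    rw [this, Matrix.mul_sub, Matrix.sub_mul, ← he, Matrix.mul_smul, Matrix.mul_one,
      Matrix.smul_mul, ← hHC]
  refine ⟨e i₀, ?_, ?_, ?_⟩
  · rw [hdiff]
    refine PosSemidef.mul_mul_conjTranspose_same (PosSemidef.diagonal fun i => ?_) C
    exact Complex.zero_le_real.mpr (sub_nonneg.mpr (hi₀ i))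
  · intro h0
    refine hRH ?_
    rw [← sub_eq_zero.mp h0]
    exact Submodule.smul_mem _ _ (Submodule.mem_span_singleton_self H)
  · rw [hdiff, det_mul, det_mul, det_diagonal, Finset.prod_eq_zero (Finset.mem_univ i₀)]
    · simp
    · simp

theorem Matrix.PosDef.exists_rank_one_fixed {ι : Type*} [Fintype ι] [DecidableEq ι]
    [Nonempty ι] {H K : Matrix ι ι ℂ} (hH : H.PosDef) (hK : Kᴴ * H * K = H) :
    ∃ w : ι → ℂ, w ≠ 0 ∧ Kᴴ * vecMulVec w (star w) * K = vecMulVec w (star w) := by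
  obtain ⟨l, hl⟩ := Module.End.exists_eigenvalue (toLin' K)
  obtain ⟨v, hv⟩ := hl.exists_hasEigenvector
  have hv0 : v ≠ 0 := hv.2
  have hKv : K *ᵥ v = l • v := hv.apply_eq_smul
  have hpos := hH.dotProduct_mulVec_pos hv0
  have hnorm : star l * l = 1 := by
    have h1 : star v ⬝ᵥ (H *ᵥ v) = (star l * l) * (star v ⬝ᵥ (H *ᵥ v)) := by
      conv_lhs => rw [← hK]
      rw [← mulVec_mulVec, ← mulVec_mulVec, dotProduct_mulVec, ← star_mulVec, hKv, mulVec_smul,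
        star_smul, smul_dotProduct, dotProduct_smul, smul_eq_mul, smul_eq_mul, mul_assoc]
    exact mul_right_cancel₀ hpos.ne' (by rw [one_mul]; exact h1.symm)
  have hw : Kᴴ *ᵥ (H *ᵥ v) = star l • (H *ᵥ v) := by
    have h1 : l • (Kᴴ *ᵥ (H *ᵥ v)) = H *ᵥ v := by
      conv_rhs => rw [← hK]
      rw [← mulVec_mulVec, ← mulVec_mulVec, hKv, mulVec_smul, mulVec_smul]
    rw [← h1, smul_smul, hnorm, one_smul, h1]
  refine ⟨H *ᵥ v, ?_, ?_⟩
  · intro h0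
    rw [h0, dotProduct_zero] at hpos
    exact lt_irrefl _ hpos
  · have h2 : star (H *ᵥ v) ᵥ* K = star (Kᴴ *ᵥ (H *ᵥ v)) := by
      rw [star_mulVec Kᴴ, conjTranspose_conjTranspose]
    rw [mul_vecMulVec, vecMulVec_mul, h2, hw, star_smul, star_star, smul_vecMulVec,
      vecMulVec_smul, smul_smul, hnorm, one_smul]

theorem exists_singular_blockDefect_eq_zero {d : ℕ} {nn : Fin d → ℕ}
    {K H : Matrix (BIdx nn) (BIdx nn) ℂ} [Nontrivial (BIdx nn)] (hH : H.PosSemidef)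
    (hH0 : H ≠ 0) (hK : blockDefect K H = 0) :
    ∃ H' : Matrix (BIdx nn) (BIdx nn) ℂ, H'.PosSemidef ∧ H' ≠ 0 ∧ H'.det = 0 ∧
      blockDefect K H' = 0 := by
  by_cases hdet : H.det = 0
  · exact ⟨H, hH, hH0, hdet, hK⟩
  have hpd : H.PosDef := hH.posDef_iff_isUnit.mpr
    ((Matrix.isUnit_iff_isUnit_det _).mpr (isUnit_iff_ne_zero.mpr hdet))
  by_cases hpq : ∃ p q : BIdx nn, p.1 ≠ q.1
  · obtain ⟨p, q, hpq⟩ := hpq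
    obtain ⟨R, hR, hKR, hRH⟩ := exists_isHermitian_blockDefect_eq_zero K H hpq
    obtain ⟨t, h1, h2, h3⟩ := hpd.exists_singular_posSemidef hR hRH
    exact ⟨_, h1, h2, h3, by rw [map_sub, map_smul, hK, hKR, smul_zero, sub_zero]⟩
  · push Not at hpq
    have hKH : Kᴴ * H * K = H := by
      ext p q
      have := congrFun hK ⟨(p, q), hpq p q⟩
      rw [blockDefect_apply, Matrix.sub_apply, Pi.zero_apply, sub_eq_zero] at this
      exact this.symm
    obtain ⟨w, hw, hKw⟩ := hpd.exists_rank_one_fixed hKH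
    refine ⟨vecMulVec w (star w), posSemidef_vecMulVec_self_star w, ?_, det_vecMulVec _ _, ?_⟩
    · rw [Ne, vecMulVec_eq_zero, not_or]
      exact ⟨hw, star_ne_zero.mpr hw⟩
    · ext x
      rw [blockDefect_apply, hKw, sub_self]
      rfl

theorem exists_unitary_ncDet_eq_zero {d : ℕ} {nn : Fin d → ℕ}
    {K H : Matrix (BIdx nn) (BIdx nn) ℂ} (c : ℂ) (hH0 : H ≠ 0) (hK : blockDefect K H = 0)
    {m : ℕ} {Y : Matrix (BIdx nn) (Fin m) ℂ} (hY : H = Y * Yᴴ) :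
    ∃ U : ∀ _ : Fin d, Matrix (Fin m) (Fin m) ℂ,
      (∀ j, U j ∈ Matrix.unitaryGroup (Fin m) ℂ) ∧ ncDet nn K c U = 0 := by
  have hblock : ∀ j, ∃ V ∈ Matrix.unitaryGroup (Fin m) ℂ,
      (Kᴴ * Y).submatrix (Sigma.mk j) id = Y.submatrix (Sigma.mk j) id * V := by
    intro j
    apply exists_unitary_of_mul_conjTranspose_eq
    ext a b
    have h1 := congrFun hK ⟨(⟨j, a⟩, ⟨j, b⟩), rfl⟩
    have h2 : Kᴴ * H * K = (Kᴴ * Y) * (Kᴴ * Y)ᴴ := by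
      rw [hY, conjTranspose_mul, conjTranspose_conjTranspose]
      simp only [Matrix.mul_assoc]
    rw [blockDefect_apply, Matrix.sub_apply, Pi.zero_apply, sub_eq_zero, h2, hY] at h1
    exact h1
  choose V hV hVY using hblock
  refine ⟨fun j => (V j)ᵀ, fun j => transpose_mem_unitaryGroup_iff.mpr (hV j), ?_⟩
  rw [ncDet, mul_eq_zero]
  right
  refine exists_vecMul_eq_zero_iff.mp ⟨fun x => star (Y x.1 x.2), ?_, ?_⟩
  · intro h0
    refine hH0 ?_
    have : Y = 0 := by
      ext p a
      exact star_eq_zero.mp (congrFun h0 (p, a))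
    rw [hY, this, Matrix.zero_mul]
  · have h1 : (fun x : BIdx nn × Fin m => star (Y x.1 x.2)) ᵥ*
        (K ⊗ₖ (1 : Matrix (Fin m) (Fin m) ℂ)) = fun x => star ((Kᴴ * Y) x.1 x.2) := by
      ext ⟨q, b⟩
      simp only [vecMul, dotProduct, kroneckerMap_apply, Fintype.sum_prod_type, Matrix.one_apply,
        Matrix.mul_apply, conjTranspose_apply, star_sum, star_mul', star_star]
      simp [mul_comm]
    have h2 : (fun x : BIdx nn × Fin m => star ((Kᴴ * Y) x.1 x.2)) ᵥ*
        oplusKron nn (fun j => (V j)ᵀ) = fun x => star (Y x.1 x.2) := by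
      ext ⟨⟨j, q⟩, b⟩
      have h3 : (Y.submatrix (Sigma.mk j) id * V j) * (V j)ᴴ = Y.submatrix (Sigma.mk j) id := by
        rw [Matrix.mul_assoc, ← star_eq_conjTranspose, mem_unitaryGroup_iff.mp (hV j),
          Matrix.mul_one]
      have h4 := congrFun (congrFun h3 q) b
      rw [← hVY] at h4
      rw [← show _ = Y ⟨j, q⟩ b from h4]
      simp only [vecMul, dotProduct, Fintype.sum_prod_type, oplusKron, Matrix.mul_apply,
        submatrix_apply, conjTranspose_apply, star_sum, star_mul', star_star, transpose_apply, id]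
      rw [Finset.sum_eq_single ⟨j, q⟩]
      · simp
      · intro p _ hp
        simp [hp]
      · simp
    rw [vecMul_sub, vecMul_one, ← vecMul_vecMul, h1, h2, sub_self]

theorem eventually_posDef_add {ι : Type*} [Fintype ι] [DecidableEq ι]
    {Q R : Matrix ι ι ℂ} (hQ : Q.PosDef) (hR : R.IsHermitian) :
    ∀ᶠ ε : ℝ in nhds 0, (Q + (ε : ℂ) • R).PosDef := by
  obtain ⟨C, hC, hQC, e, he⟩ := hQ.exists_simultaneous_diagonal hR
  have h1 : ∀ᶠ ε : ℝ in nhds 0, ∀ i, 0 < 1 + ε * e i := by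
    rw [Filter.eventually_all]
    intro i
    have : Continuous fun ε : ℝ => 1 + ε * e i := by fun_prop
    exact this.continuousAt.eventually (lt_mem_nhds (by simp))
  filter_upwards [h1] with ε hε
  have : Q + (ε : ℂ) • R = C * diagonal (fun i => ((1 + ε * e i : ℝ) : ℂ)) * Cᴴ := by
    have h2 : diagonal (fun i => ((1 + ε * e i : ℝ) : ℂ)) =
        (1 : Matrix ι ι ℂ) + (ε : ℂ) • diagonal (fun i => (e i : ℂ)) := by
      rw [← diagonal_one, ← diagonal_smul, diagonal_add]
      simp
    rw [h2, Matrix.mul_add, Matrix.add_mul, Matrix.mul_one, ← hQC, Matrix.mul_smul,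
      Matrix.smul_mul, ← he]
  rw [this, ← star_eq_conjTranspose, hC.posDef_star_right_conjugate_iff, posDef_diagonal_iff]
  exact fun i => Complex.zero_lt_real.mpr (hε i)

theorem structSimStrictContr_of_posDef {d : ℕ} {nn : Fin d → ℕ}
    {K : Matrix (BIdx nn) (BIdx nn) ℂ} {P : ∀ j, Matrix (Fin (nn j)) (Fin (nn j)) ℂ}
    (hP : ∀ j, (P j).IsHermitian)
    (hK : (blockDiagonal' P - K * blockDiagonal' P * Kᴴ).PosDef) :
    StructSimStrictContr nn K := by
  choose U hU e he using fun j => (hP j).exists_unitary_diagonal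
  obtain ⟨ε, hε, hne⟩ : ∃ ε : ℝ,
      (blockDiagonal' P - K * blockDiagonal' P * Kᴴ + (ε : ℂ) • (1 - K * Kᴴ)).PosDef ∧
      ∀ i : BIdx nn, e i.1 i.2 + ε ≠ 0 := by
    have h1 : ∀ᶠ ε : ℝ in nhdsWithin 0 {0}ᶜ, ∀ i : BIdx nn, e i.1 i.2 + ε ≠ 0 := by
      rw [Filter.eventually_all]
      intro i
      by_cases hi : e i.1 i.2 = 0
      · filter_upwards [self_mem_nhdsWithin] with ε hε
        rw [hi, zero_add]
        exact hε
      · refine Filter.Eventually.filter_mono nhdsWithin_le_nhds ?_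
        have : Continuous fun ε : ℝ => e i.1 i.2 + ε := by fun_prop
        exact this.continuousAt.eventually_ne (by simpa using hi)
    exact (((eventually_posDef_add hK (isHermitian_one.sub
      (isHermitian_mul_conjTranspose_self K))).filter_mono nhdsWithin_le_nhds).and h1).exists
  let r : ∀ j, Fin (nn j) → ℝ := fun j i => e j i + ε
  let S : ∀ j, Matrix (Fin (nn j)) (Fin (nn j)) ℂ :=
    fun j => U j * diagonal (fun i => (Real.sqrt |r j i| : ℂ))
  let σ : ∀ j, Fin (nn j) → ℂ := fun j i => if 0 < r j i then 1 else -1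
  have hSJ : ∀ j, S j * diagonal (σ j) * (S j)ᴴ = P j + (ε : ℂ) • 1 := by
    intro j
    have h1 : U j * (U j)ᴴ = 1 := mem_unitaryGroup_iff.mp (hU j)
    have h2 : P j + (ε : ℂ) • 1 = U j * diagonal (fun i => (r j i : ℂ)) * (U j)ᴴ := by
      have h3 : diagonal (fun i => (r j i : ℂ)) =
          diagonal (fun i => (e j i : ℂ)) + (ε : ℂ) • (1 : Matrix _ _ ℂ) := by
        rw [smul_one_eq_diagonal, diagonal_add]
        simp [r]
      rw [h3, Matrix.mul_add, Matrix.add_mul, ← he, Matrix.mul_smul, Matrix.mul_one,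
        Matrix.smul_mul, h1]
    rw [h2, conjTranspose_mul, diagonal_conjTranspose]
    simp only [S, Matrix.mul_assoc]
    rw [← Matrix.mul_assoc (diagonal (σ j)), diagonal_mul_diagonal,
      ← Matrix.mul_assoc (diagonal _), diagonal_mul_diagonal]
    congr 3
    ext i
    simp only [Pi.star_apply, RCLike.star_def, Complex.conj_ofReal, σ]
    have h4 := Real.mul_self_sqrt (abs_nonneg (r j i))
    split_ifs with h
    · rw [one_mul, ← Complex.ofReal_mul, h4, abs_of_pos h]
    · rw [neg_one_mul, mul_neg, ← Complex.ofReal_mul, h4, abs_of_nonpos (not_lt.mp h)]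
      simp
  have hS : ∀ j, IsUnit (S j) := fun j => by
    refine (isUnit_of_mem_unitaryGroup (hU j)).mul ?_
    rw [Matrix.isUnit_iff_isUnit_det, det_diagonal, isUnit_iff_ne_zero, Finset.prod_ne_zero_iff]
    exact fun i _ => Complex.ofReal_ne_zero.mpr (Real.sqrt_pos.mpr (abs_pos.mpr (hne ⟨j, i⟩))).ne'
  have hSu : IsUnit (blockDiagonal' S) := by
    refine IsUnit.of_mul_eq_one (blockDiagonal' fun j => (S j)⁻¹) ?_
    rw [← blockDiagonal'_mul, ← blockDiagonal'_one]
    congr 1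
    ext1 j
    exact mul_nonsing_inv _ ((Matrix.isUnit_iff_isUnit_det _).mp (hS j))
  refine ⟨S, hSu, diagonal (fun i => σ i.1 i.2), ⟨fun i => σ i.1 i.2, fun i => ?_, rfl⟩, ?_⟩
  · by_cases h : 0 < r i.1 i.2 <;> simp [σ, h]
  set T := blockDiagonal' S with hT
  set J : Matrix (BIdx nn) (BIdx nn) ℂ := diagonal (fun i => σ i.1 i.2) with hJ
  have hTJ : T * J * Tᴴ = blockDiagonal' P + (ε : ℂ) • 1 := by
    rw [hT, hJ, ← blockDiagonal'_diagonal, blockDiagonal'_conjTranspose, ← blockDiagonal'_mul,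
      ← blockDiagonal'_mul, ← blockDiagonal'_one, ← blockDiagonal'_smul, ← blockDiagonal'_add]
    congr 1
    ext1 j
    exact hSJ j
  have hTd : IsUnit T.det := (Matrix.isUnit_iff_isUnit_det _).mp hSu
  rw [← hSu.posDef_star_right_conjugate_iff]
  convert hε using 1
  have h1 : T * (T⁻¹ * K * T) = K * T := by
    rw [Matrix.mul_assoc, mul_nonsing_inv_cancel_left _ _ hTd]
  have h2 : T * (J - T⁻¹ * K * T * J * (T⁻¹ * K * T)ᴴ) * star T =
      T * J * Tᴴ - (T * (T⁻¹ * K * T)) * J * (T * (T⁻¹ * K * T))ᴴ := by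
    rw [conjTranspose_mul T, star_eq_conjTranspose]
    simp only [Matrix.mul_sub, Matrix.sub_mul, Matrix.mul_assoc]
  have h3 : K * T * J * (K * T)ᴴ = K * (T * J * Tᴴ) * Kᴴ := by
    rw [conjTranspose_mul]
    simp only [Matrix.mul_assoc]
  rw [h2, h1, h3, hTJ, Matrix.mul_add, Matrix.add_mul, Matrix.mul_smul, Matrix.mul_one,
    Matrix.smul_mul, smul_sub]
  abel

theorem stmt3 {d : ℕ} (nn : Fin d → ℕ) (hnn : ∀ j, 0 < nn j)
    (hn2 : 2 ≤ ∑ j, nn j)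
    (K : Matrix (BIdx nn) (BIdx nn) ℂ) (c : ℂ) (hc : c ≠ 0)
    (h : ∀ (m : ℕ), 1 ≤ m → m ≤ (∑ j, nn j) - 1 →
      ∀ U : ∀ _ : Fin d, Matrix (Fin m) (Fin m) ℂ,
        (∀ j, U j ∈ Matrix.unitaryGroup (Fin m) ℂ) → ncDet nn K c U ≠ 0) :
    StructSimStrictContr nn K := by
  rcases exists_posDef_or_blockDefect_eq_zero K with ⟨P, hP, hK⟩ | ⟨H, hH, hH0, hK⟩
  · exact structSimStrictContr_of_posDef hP hK
  exfalso
  have hcard : Fintype.card (BIdx nn) = ∑ j, nn j := by simp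
  have : Nontrivial (BIdx nn) := Fintype.one_lt_card_iff_nontrivial.mp (by omega)
  obtain ⟨H', hH', hH'0, hdet, hK'⟩ := exists_singular_blockDefect_eq_zero hH hH0 hK
  obtain ⟨Y, hY⟩ := hH'.exists_factor_of_det_eq_zero hdet (N := ∑ j, nn j - 1) (by omega)
  obtain ⟨U, hU, hU0⟩ := exists_unitary_ncDet_eq_zero c hH'0 hK' hY
  exact h _ (by omega) le_rfl U hU hU0
end

section
/- Let K ∈ ℂ^{n×n} with n = n₁+⋯+n_d and let c ∈ ℂ be nonzero. Suppose U₁,…,U_d ∈ ℂ^{m×m} are unitary matrices with c·det(I_n ⊗ I_m − (K ⊗ I_m)(⊕_{j=1}^d I_{n_j} ⊗ U_j)) = 0. Then there exists a nonzero X ∈ ℂ^{n×m}, with block decomposition X = col(X₁,…,X_d), X_j ∈ ℂ^{n_j×m}, such that the j-th block of K*X equals X_j U_jᵀ for each j, and L = XX* is a nonzero positive semidefinite element of 𝒲_K^⊥. -/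
open Matrix Kronecker
open scoped ComplexOrder

/-- The real subspace `𝒲_K = {⊕_j H_j − K (⊕_j H_j) K* : H_j Hermitian}` of `ℋ_n`. -/
def WK {d : ℕ} (nn : Fin d → ℕ) (K : Matrix (BIdx nn) (BIdx nn) ℂ) :
    Set (Matrix (BIdx nn) (BIdx nn) ℂ) :=
  { W | ∃ H : ∀ j : Fin d, Matrix (Fin (nn j)) (Fin (nn j)) ℂ,
      (∀ j, (H j).IsHermitian) ∧
      W = Matrix.blockDiagonal' H - K * Matrix.blockDiagonal' H * Kᴴ }

/-- The orthogonal complement `𝒲_K^⊥` of `𝒲_K` inside the Hermitian matrices `ℋ_n`,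
with respect to the trace inner product `⟨A,B⟩ = Tr(AB)`. -/
def WKperp {d : ℕ} (nn : Fin d → ℕ) (K : Matrix (BIdx nn) (BIdx nn) ℂ) :
    Set (Matrix (BIdx nn) (BIdx nn) ℂ) :=
  { L | L.IsHermitian ∧ ∀ W ∈ WK nn K, Matrix.trace (L * W) = 0 }

/-- The `j`-th block `X_j ∈ ℂ^{n_j × m}` of `X = col(X₁,…,X_d) ∈ ℂ^{n × m}`. -/
def blk {d : ℕ} (nn : Fin d → ℕ) {m : ℕ} (X : Matrix (BIdx nn) (Fin m) ℂ)
    (j : Fin d) : Matrix (Fin (nn j)) (Fin m) ℂ :=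
  fun a k => X ⟨j, a⟩ k

theorem oplusKron_mulVec {d : ℕ} (nn : Fin d → ℕ) {m : ℕ}
    (U : ∀ _ : Fin d, Matrix (Fin m) (Fin m) ℂ) (x : BIdx nn × Fin m → ℂ)
    (p : BIdx nn × Fin m) :
    (oplusKron nn U *ᵥ x) p = ∑ l, U p.1.1 p.2 l * x (p.1, l) := by
  simp only [Matrix.mulVec, dotProduct, oplusKron, Fintype.sum_prod_type]
  rw [Finset.sum_eq_single p.1 (fun b _ hb => by simp [hb.symm]) (by simp)]
  simp

theorem oplusKron_mul_conjTranspose {d : ℕ} (nn : Fin d → ℕ) {m : ℕ}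
    (U : ∀ _ : Fin d, Matrix (Fin m) (Fin m) ℂ)
    (hU : ∀ j, U j ∈ Matrix.unitaryGroup (Fin m) ℂ) :
    oplusKron nn U * (oplusKron nn U)ᴴ = 1 := by
  have h : oplusKron nn U =
      (blockDiagonal fun p : BIdx nn => U p.1).submatrix Prod.swap Prod.swap := by
    ext p q
    simp [oplusKron, blockDiagonal_apply]
  rw [h, conjTranspose_submatrix, blockDiagonal_conjTranspose,
    submatrix_mul _ _ _ _ _ Prod.swap_bijective |>.symm, ← blockDiagonal_mul]
  have h1 : (fun p : BIdx nn => U p.1 * (U p.1)ᴴ) = 1 :=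
    funext fun p => Matrix.mem_unitaryGroup_iff.mp (hU p.1)
  rw [h1, blockDiagonal_one]
  exact submatrix_one _ Prod.swap_injective

theorem trace_mul_blockDiagonal' {d : ℕ} (nn : Fin d → ℕ)
    (L : Matrix (BIdx nn) (BIdx nn) ℂ)
    (H : ∀ j : Fin d, Matrix (Fin (nn j)) (Fin (nn j)) ℂ) :
    (L * blockDiagonal' H).trace = ∑ j, (blockDiag' L j * H j).trace := by
  simp only [Matrix.trace, Matrix.diag, Matrix.mul_apply, Fintype.sum_sigma, blockDiag'_apply]
  refine Finset.sum_congr rfl fun j _ => Finset.sum_congr rfl fun a _ => ?_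
  rw [Finset.sum_eq_single j (fun b _ hb => by simp [blockDiagonal'_apply_ne _ _ _ hb]) (by simp)]
  simp

theorem blockDiag'_mul_conjTranspose {d : ℕ} (nn : Fin d → ℕ) {m : ℕ}
    (X : Matrix (BIdx nn) (Fin m) ℂ) (j : Fin d) :
    blockDiag' (X * Xᴴ) j = blk nn X j * (blk nn X j)ᴴ := by
  ext a b
  simp [blockDiag'_apply, Matrix.mul_apply, blk]

/-- If the blocks of `K* X` and `X` differ by unitary right factors, then `X X*` lies in
`𝒲_K^⊥`. -/
theorem mul_conjTranspose_mem_WKperp {d : ℕ} (nn : Fin d → ℕ) {m : ℕ}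
    (K : Matrix (BIdx nn) (BIdx nn) ℂ) (X : Matrix (BIdx nn) (Fin m) ℂ)
    (V : ∀ _ : Fin d, Matrix (Fin m) (Fin m) ℂ) (hV : ∀ j, V j * (V j)ᴴ = 1)
    (hX : ∀ j, blk nn (Kᴴ * X) j = blk nn X j * V j) :
    X * Xᴴ ∈ WKperp nn K := by
  refine ⟨isHermitian_mul_conjTranspose_self X, ?_⟩
  rintro W ⟨H, -, rfl⟩
  have h : (X * Xᴴ * (K * blockDiagonal' H * Kᴴ)).trace =
      ((Kᴴ * X) * (Kᴴ * X)ᴴ * blockDiagonal' H).trace := by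
    rw [← Matrix.mul_assoc, Matrix.trace_mul_comm]
    simp only [conjTranspose_mul, conjTranspose_conjTranspose, Matrix.mul_assoc]
  rw [Matrix.mul_sub, Matrix.trace_sub, h, trace_mul_blockDiagonal', trace_mul_blockDiagonal',
    sub_eq_zero]
  refine Finset.sum_congr rfl fun j _ => ?_
  rw [blockDiag'_mul_conjTranspose, blockDiag'_mul_conjTranspose, hX, conjTranspose_mul,
    Matrix.mul_assoc (blk nn X j) (V j), ← Matrix.mul_assoc (V j), hV, Matrix.one_mul]

theorem stmt12 {d : ℕ} (nn : Fin d → ℕ) (hnn : ∀ j, 0 < nn j)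
    (K : Matrix (BIdx nn) (BIdx nn) ℂ) (c : ℂ) (hc : c ≠ 0) {m : ℕ}
    (U : ∀ _ : Fin d, Matrix (Fin m) (Fin m) ℂ)
    (hU : ∀ j, U j ∈ Matrix.unitaryGroup (Fin m) ℂ)
    (h0 : ncDet nn K c U = 0) :
    ∃ X : Matrix (BIdx nn) (Fin m) ℂ, X ≠ 0 ∧
      (∀ j, blk nn (Kᴴ * X) j = blk nn X j * (U j)ᵀ) ∧
      X * Xᴴ ≠ 0 ∧ (X * Xᴴ).PosSemidef ∧ X * Xᴴ ∈ WKperp nn K := by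
  have hdet := (mul_eq_zero.mp h0).resolve_left hc
  obtain ⟨x, hx0, hx⟩ := exists_mulVec_eq_zero_iff.mpr
    ((det_conjTranspose _).trans ((congrArg star hdet).trans (star_zero ℂ)))
  have hDx : oplusKron nn U *ᵥ x = (Kᴴ ⊗ₖ (1 : Matrix (Fin m) (Fin m) ℂ)) *ᵥ x := by
    rw [conjTranspose_sub, conjTranspose_one, conjTranspose_mul, conjTranspose_kronecker,
      conjTranspose_one, sub_mulVec, one_mulVec, sub_eq_zero] at hx
    conv_lhs => rw [hx]
    rw [mulVec_mulVec, ← Matrix.mul_assoc, oplusKron_mul_conjTranspose nn U hU, Matrix.one_mul]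
  let X : Matrix (BIdx nn) (Fin m) ℂ := of fun i k => x (i, k)
  have hX0 : X ≠ 0 := fun h => hx0 (funext fun p => congrFun (congrFun h p.1) p.2)
  have hX : ∀ j, blk nn (Kᴴ * X) j = blk nn X j * (U j)ᵀ := by
    intro j
    ext a k
    have h := congrFun hDx (⟨j, a⟩, k)
    rw [oplusKron_mulVec] at h
    simp only [Matrix.mulVec, dotProduct, Fintype.sum_prod_type, kroneckerMap_apply, one_apply,
      mul_ite, mul_one, mul_zero, ite_mul, zero_mul, Finset.sum_ite_eq, Finset.mem_univ,
      if_true] at h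
    rw [blk, Matrix.mul_apply, Matrix.mul_apply]
    exact h.symm.trans (Finset.sum_congr rfl fun l _ => mul_comm _ _)
  refine ⟨X, hX0, hX, fun h => hX0 (self_mul_conjTranspose_eq_zero.mp h),
    posSemidef_self_mul_conjTranspose X, mul_conjTranspose_mem_WKperp nn K X _ (fun j => ?_) hX⟩
  have h := congrArg transpose (Matrix.mem_unitaryGroup_iff'.mp (hU j))
  rwa [star_eq_conjTranspose, transpose_mul, transpose_one] at h
end
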